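/- Boundary inequality for small δ: there exists δ1 ∈ (0, δ0/2), independent of λ, such that for every δ ∈ (0, δ1], every λ > 0, every maximizer (ω^λ, x_{p+1}^λ, …, x_k^λ) of ℰ over N_p^λ × B̄_δ(x̄_{p+1}) × ⋯ × B̄_δ(x̄_k), and every i ∈ {1,…,p}, one has sgn(κ_i)(ψ^λ(x) + Σ_{j=p+1}^k κ_jG(x_j^λ,x)) − c_i^λ ≤ 0 for all x on the sphere ∂B_{δ0}(x̄_i). -/

import Mathlib

open MeasureTheory Metric Real Filter Topology

noncomputable section

abbrev E2 := EuclideanSpace ℝ (Fin 2)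

theorem integrableOn_log_norm_closedBall (R : ℝ) :
    IntegrableOn (fun y : E2 => log ‖y‖) (closedBall 0 R) := by
  have key : Integrable (fun y : E2 => (Set.Iic R).indicator log ‖y‖) := by
    rw [integrable_fun_norm_addHaar volume (E := E2) (f := (Set.Iic R).indicator log)]
    have hd : Module.finrank ℝ E2 = 2 := by simp
    rw [hd]
    have h1 : IntegrableOn (fun y : ℝ => y * log y) (Set.Icc 0 R) :=
      continuous_mul_log.continuousOn.integrableOn_compact isCompact_Icc
    have h2 : Integrable ((Set.Icc 0 R).indicator (fun y : ℝ => y * log y)) :=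
      (integrable_indicator_iff measurableSet_Icc).2 h1
    refine (h2.integrableOn (s := Set.Ioi 0)).congr_fun (fun y hy => ?_) measurableSet_Ioi
    have hy0 : 0 ≤ y := le_of_lt hy
    by_cases hyR : y ≤ R
    · simp [Set.indicator, hyR, hy0]
    · simp [Set.indicator, hyR]
  rw [← integrable_indicator_iff measurableSet_closedBall]
  exact key.congr (Eventually.of_forall fun y => by simp [Set.indicator])

theorem integrableOn_log_dist (x c : E2) (R : ℝ) :
    IntegrableOn (fun y : E2 => log (dist x y)) (closedBall c R) := by
  have h1 := (integrable_indicator_iff measurableSet_closedBall).2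
    (integrableOn_log_norm_closedBall (R + dist c x))
  have h2 := h1.comp_sub_right x
  rw [← integrable_indicator_iff measurableSet_closedBall]
  have h3 := h2.indicator (measurableSet_closedBall (x := c) (ε := R))
  convert h3 using 1
  ext y
  simp only [Set.indicator]
  split_ifs with h4 h5
  · rw [dist_comm, dist_eq_norm]
  · exfalso
    apply h5
    rw [mem_closedBall] at *
    rw [dist_zero_right, ← dist_eq_norm]
    linarith [dist_triangle y c x]
  · rfl

theorem le_essInf_real_of_ae_le {α : Type*} [MeasurableSpace α] {μ : Measure α} (hμ : μ ≠ 0)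
    {f : α → ℝ} {a : ℝ} (hf : ∀ᵐ x ∂μ, a ≤ f x) : a ≤ essInf f μ := by
  have : NeBot (ae μ) := ae_neBot.2 hμ
  rw [essInf, liminf_eq]
  refine le_csSup ?_ hf
  by_contra hb
  rw [not_bddAbove_iff] at hb
  have h1 : ∀ n : ℕ, ∀ᵐ x ∂μ, (n : ℝ) < f x := by
    intro n
    obtain ⟨b, hb1, hb2⟩ := hb n
    filter_upwards [hb1] with x hx
    exact hb2.trans_le hx
  obtain ⟨x, hx⟩ := (ae_all_iff.2 h1).exists
  obtain ⟨n, hn⟩ := exists_nat_gt (f x)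
  exact lt_asymm hn (hx n)

/-- A vorticity patch: a measurable function vanishing off a ball, of the sign of its total mass
and essentially bounded. -/
structure IsPatch (D : Set E2) (c : E2) (δ lam k : ℝ) (w : E2 → ℝ) : Prop where
  measurable : Measurable w
  eq_zero : ∀ x, x ∉ ball c δ → w x = 0
  integral_eq : ∫ x in D, w x = k
  ae_bound : ∀ᵐ x : E2 ∂volume, 0 ≤ Real.sign k * w x ∧ Real.sign k * w x ≤ lam

namespace IsPatch

variable {D : Set E2} {c : E2} {δ lam k : ℝ} {w : E2 → ℝ}

theorem ae_abs_eq (hw : IsPatch D c δ lam k w) (hk : k ≠ 0) :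
    ∀ᵐ x : E2 ∂volume, |w x| = Real.sign k * w x := by
  filter_upwards [hw.ae_bound] with x hx
  rw [← abs_of_nonneg hx.1, abs_mul]
  rcases Real.sign_apply_eq_of_ne_zero k hk with h | h <;> simp [h]

theorem integrable_mul (hw : IsPatch D c δ lam k w) (hk : k ≠ 0)
    {g : E2 → ℝ} (hg : AEStronglyMeasurable g (volume.restrict D)) {b : E2 → ℝ}
    (hb : IntegrableOn b (ball c δ)) (hgb : ∀ y ∈ ball c δ, |g y| ≤ b y) :
    Integrable (fun y => g y * w y) (volume.restrict D) := by
  have h1 : Integrable (fun y => lam * (ball c δ).indicator b y) (volume.restrict D) :=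
    (((integrable_indicator_iff measurableSet_ball).2 hb).const_mul lam).restrict
  refine h1.mono' (hg.mul hw.measurable.aestronglyMeasurable) ?_
  filter_upwards [ae_restrict_of_ae hw.ae_bound, ae_restrict_of_ae (hw.ae_abs_eq hk)] with y h2 h3
  by_cases hy : y ∈ ball c δ
  · rw [Set.indicator_of_mem hy, norm_mul, Real.norm_eq_abs, Real.norm_eq_abs, mul_comm lam, h3]
    exact mul_le_mul (hgb y hy) h2.2 h2.1 ((abs_nonneg _).trans (hgb y hy))
  · simp [hy, hw.eq_zero y hy]

theorem integrable (hw : IsPatch D c δ lam k w) (hk : k ≠ 0) :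
    Integrable w (volume.restrict D) := by
  simpa using hw.integrable_mul hk (g := fun _ => 1) (b := fun _ => 1)
    aestronglyMeasurable_const (integrableOn_const (measure_ball_lt_top).ne) (by simp)

theorem integral_sign_mul (hw : IsPatch D c δ lam k w) :
    ∫ y in D, Real.sign k * w y = |k| := by
  rw [integral_const_mul, hw.integral_eq, mul_comm]
  rcases lt_trichotomy k 0 with h | h | h
  · simp [Real.sign_of_neg h, abs_of_neg h]
  · simp [h]
  · simp [Real.sign_of_pos h, abs_of_pos h]

theorem abs_integral_mul_le (hw : IsPatch D c δ lam k w) (hk : k ≠ 0)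
    {g : E2 → ℝ} {C : ℝ} (hgC : ∀ y ∈ ball c δ, |g y| ≤ C) :
    |∫ y in D, g y * w y| ≤ C * |k| := by
  rw [← hw.integral_sign_mul, ← integral_const_mul, ← Real.norm_eq_abs]
  refine norm_integral_le_of_norm_le (((hw.integrable hk).const_mul _).const_mul _) ?_
  filter_upwards [ae_restrict_of_ae hw.ae_bound, ae_restrict_of_ae (hw.ae_abs_eq hk)] with y h2 h3
  by_cases hy : y ∈ ball c δ
  · rw [norm_mul, Real.norm_eq_abs, Real.norm_eq_abs, h3]
    exact mul_le_mul_of_nonneg_right (hgC y hy) h2.1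
  · simp [hw.eq_zero y hy]

theorem le_sign_mul_integral_mul (hw : IsPatch D c δ lam k w) (hk : k ≠ 0)
    {g : E2 → ℝ} {C : ℝ} (hint : Integrable (fun y => g y * w y) (volume.restrict D))
    (hgC : ∀ᵐ y : E2, y ∈ ball c δ → C ≤ g y) :
    C * |k| ≤ Real.sign k * ∫ y in D, g y * w y := by
  rw [← hw.integral_sign_mul, ← integral_const_mul, ← integral_const_mul]
  refine integral_mono_ae (((hw.integrable hk).const_mul _).const_mul _) (hint.const_mul _) ?_
  filter_upwards [ae_restrict_of_ae hw.ae_bound, ae_restrict_of_ae hgC] with y h2 h3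
  by_cases hy : y ∈ ball c δ
  · have := mul_le_mul_of_nonneg_right (h3 hy) h2.1
    calc _ ≤ _ := this
      _ = _ := by ring
  · simp [hw.eq_zero y hy]

theorem restrict_ne_zero (hw : IsPatch D c δ lam k w) (hk : k ≠ 0) :
    volume.restrict {x ∈ ball c δ | 0 < Real.sign k * w x} ≠ 0 := by
  intro h0
  rw [Measure.restrict_eq_zero] at h0
  apply hk
  rw [← hw.integral_eq]
  refine integral_eq_zero_of_ae (ae_restrict_of_ae ?_)
  filter_upwards [hw.ae_bound, hw.ae_abs_eq hk, measure_eq_zero_iff_ae_notMem.1 h0] with y h1 h2 h3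
  by_cases hy : y ∈ ball c δ
  · have : ¬ 0 < Real.sign k * w y := fun h => h3 ⟨hy, h⟩
    have h4 : |w y| = 0 := by linarith [h1.1]
    simpa using h4
  · simp [hw.eq_zero y hy]

end IsPatch

theorem boundary_inequality
    (p l : ℕ) (hp : 0 < p) (hl : 0 < l)
    (D : Set E2) (hDopen : IsOpen D) (hDbdd : Bornology.IsBounded D)
    (hDsc : SimplyConnectedSpace D)
    (h : E2 → E2 → ℝ)
    (hcont : ContinuousOn (fun q : E2 × E2 => h q.1 q.2) (D ×ˢ D))
    (hsymm : ∀ x ∈ D, ∀ y ∈ D, h x y = h y x)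
    (hharm : ∀ y ∈ D, ContDiffOn ℝ 2 (fun x => h x y) D ∧
      ∀ x ∈ D, ∑ i : Fin 2,
        iteratedFDerivWithin ℝ 2 (fun x' => h x' y) D x
          ![EuclideanSpace.single i 1, EuclideanSpace.single i 1] = 0)
    (G : E2 → E2 → ℝ)
    (hG : ∀ x y, G x y = (1 / (2 * π)) * Real.log (1 / dist x y) - h x y)
    (hGbdry : ∀ y ∈ D, ∀ z ∈ frontier D,
      Tendsto (fun x => G x y) (𝓝[D] z) (𝓝 0))
    (κ : Fin (p + l) → ℝ) (hκ : ∀ i, κ i ≠ 0)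
    (xb : Fin (p + l) → E2) (hxbD : ∀ i, xb i ∈ D) (hxbinj : Function.Injective xb)
    (δ0 : ℝ) (hδ0 : 0 < δ0)
    (hball : ∀ i, closedBall (xb i) δ0 ⊆ D)
    (hdisj : ∀ i j, i ≠ j → Disjoint (closedBall (xb i) δ0) (closedBall (xb j) δ0))
    (KR : (Fin (p + l) → E2) → ℝ)
    (hKR : ∀ y, KR y =
      -(∑ i, ∑ j ∈ Finset.univ.filter (fun j => j ≠ i), κ i * κ j * G (y i) (y j))
      + ∑ i, (κ i) ^ 2 * h (y i) (y i))
    (hmin : ∀ y : Fin (p + l) → E2, (∀ i, y i ∈ closedBall (xb i) δ0) →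
      Function.Injective y → y ≠ xb → KR xb < KR y)
    (ψ : (E2 → ℝ) → E2 → ℝ)
    (hψ : ∀ ω x, ψ ω x = ∫ y in D, G x y * ω y)
    (En : (E2 → ℝ) → ℝ)
    (hEn : ∀ ω, En ω = (1 / 2) * ∫ x in D, ∫ y in D, G x y * ω x * ω y)
    (EE : (E2 → ℝ) → (Fin l → E2) → ℝ)
    (hEE : ∀ ω z, EE ω z = En ω
      + ∑ j, κ (Fin.natAdd p j) * ψ ω (z j)
      + (1 / 2) * ∑ i, ∑ j ∈ Finset.univ.filter (fun j => j ≠ i),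
          κ (Fin.natAdd p i) * κ (Fin.natAdd p j) * G (z i) (z j)
      - ∑ j, (κ (Fin.natAdd p j)) ^ 2 * ((1 / 2) * h (z j) (z j)))
    (Adm : ℝ → ℝ → (Fin p → E2 → ℝ) → Prop)
    (hAdm : ∀ δ lam ωs, Adm δ lam ωs ↔ ∀ i : Fin p,
      Measurable (ωs i)
      ∧ (∀ x, x ∉ ball (xb (Fin.castAdd l i)) δ → ωs i x = 0)
      ∧ (∫ x in D, ωs i x) = κ (Fin.castAdd l i)
      ∧ (∀ᵐ x : E2 ∂volume, 0 ≤ Real.sign (κ (Fin.castAdd l i)) * ωs i x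
          ∧ Real.sign (κ (Fin.castAdd l i)) * ωs i x ≤ lam))
    :
    ∃ δ1, 0 < δ1 ∧ δ1 < δ0 / 2 ∧
      ∀ δ, 0 < δ → δ ≤ δ1 → ∀ lam, 0 < lam →
      ∀ (ωs : Fin p → E2 → ℝ) (z : Fin l → E2),
      (Adm δ lam ωs ∧ (∀ j, z j ∈ closedBall (xb (Fin.natAdd p j)) δ) ∧
      (∀ (ωs' : Fin p → E2 → ℝ) (z' : Fin l → E2), Adm δ lam ωs' →
        (∀ j, z' j ∈ closedBall (xb (Fin.natAdd p j)) δ) →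
        EE (∑ i, ωs' i) z' ≤ EE (∑ i, ωs i) z)) →
      ∀ i : Fin p, ∀ x ∈ sphere (xb (Fin.castAdd l i)) δ0,
        Real.sign (κ (Fin.castAdd l i)) * (ψ (∑ i', ωs i') x + ∑ j, κ (Fin.natAdd p j) * G (z j) x) -
          (essInf (fun x => Real.sign (κ (Fin.castAdd l i)) * (ψ (∑ i', ωs i') x + ∑ j, κ (Fin.natAdd p j) * G (z j) x))
        (volume.restrict {x ∈ ball (xb (Fin.castAdd l i)) δ | 0 < Real.sign (κ (Fin.castAdd l i)) * ωs i x})) ≤ 0 := by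
  
  classical
  set K : Set E2 := ⋃ i, closedBall (xb i) δ0 with hK
  have hKc : IsCompact K := isCompact_iUnion fun i => isCompact_closedBall _ _
  have hKD : K ⊆ D := Set.iUnion_subset hball
  have hmemK : ∀ i, ∀ x ∈ closedBall (xb i) δ0, x ∈ K := fun i x hx => Set.mem_iUnion.2 ⟨i, hx⟩
  have hhK : ContinuousOn (fun q : E2 × E2 => h q.1 q.2) (K ×ˢ K) :=
    hcont.mono (Set.prod_mono hKD hKD)
  obtain ⟨M, hM⟩ := (hKc.prod hKc).exists_bound_of_continuousOn hhK
  have hM' : ∀ x ∈ K, ∀ y ∈ K, |h x y| ≤ M := fun x hx y hy => hM (x, y) ⟨hx, hy⟩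
  obtain ⟨C, hC0, hC⟩ : ∃ C, 0 ≤ C ∧
      ∀ x ∈ K, ∀ y ∈ K, δ0 / 2 ≤ dist x y → |G x y| ≤ C := by
    have hcpt : IsCompact ((K ×ˢ K) ∩ {q : E2 × E2 | δ0 / 2 ≤ dist q.1 q.2}) :=
      (hKc.prod hKc).inter_right (isClosed_le continuous_const continuous_dist)
    have hGc : ContinuousOn (fun q : E2 × E2 => G q.1 q.2)
        ((K ×ˢ K) ∩ {q : E2 × E2 | δ0 / 2 ≤ dist q.1 q.2}) := by
      simp only [hG]
      refine ContinuousOn.sub (continuousOn_const.mul (ContinuousOn.log ?_ ?_))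
        (hhK.mono Set.inter_subset_left)
      · refine continuousOn_const.div continuous_dist.continuousOn ?_
        rintro q ⟨-, hq⟩
        simp only [Set.mem_ofPred_eq] at hq
        linarith
      · rintro q ⟨-, hq⟩
        simp only [Set.mem_ofPred_eq] at hq
        have : 0 < dist q.1 q.2 := by linarith
        positivity
    obtain ⟨C, hC⟩ := hcpt.exists_bound_of_continuousOn hGc
    exact ⟨max C 0, le_max_right _ _, fun x hx y hy hxy =>
      (hC (x, y) ⟨⟨hx, hy⟩, hxy⟩).trans (le_max_left _ _)⟩
  set A : ℝ := ∑ i, |κ i| with hA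
  clear_value A
  obtain ⟨N, hN⟩ := (Set.finite_range fun i => M + 2 * C * A / |κ i|).bddAbove
  have hN' : ∀ i, 2 * C * A ≤ (N - M) * |κ i| := by
    intro i
    have h1 : M + 2 * C * A / |κ i| ≤ N := hN ⟨i, rfl⟩
    rw [← div_le_iff₀ (abs_pos.2 (hκ i))]
    linarith
  refine ⟨min (δ0 / 4) (exp (-(2 * π * N)) / 2), by positivity,
    (min_le_left _ _).trans_lt (by linarith), ?_⟩
  rintro δ hδ hδ1 lam - ωs z ⟨hadm, hz, -⟩ i
  have hδ2 : δ ≤ δ0 / 4 := hδ1.trans (min_le_left _ _)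
  have hδ3 : δ ≤ exp (-(2 * π * N)) / 2 := hδ1.trans (min_le_right _ _)
  have hpatch : ∀ i', IsPatch D (xb (Fin.castAdd l i')) δ lam (κ (Fin.castAdd l i')) (ωs i') :=
    fun i' => let H := (hAdm δ lam ωs).1 hadm i'; ⟨H.1, H.2.1, H.2.2.1, H.2.2.2⟩
  have hballK : ∀ i, ∀ x ∈ closedBall (xb i) δ, x ∈ K := fun i x hx =>
    hmemK i x (closedBall_subset_closedBall (by linarith) hx)
  have hGmeas : ∀ x ∈ K, AEStronglyMeasurable (fun y => G x y) (volume.restrict D) := by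
    intro x hx
    have h1 : ContinuousOn (fun y => h x y) D :=
      hcont.comp (continuousOn_const.prodMk continuousOn_id) fun y hy => ⟨hKD hx, hy⟩
    simp only [hG]
    refine AEStronglyMeasurable.sub (Measurable.aestronglyMeasurable ?_)
      (h1.aestronglyMeasurable hDopen.measurableSet)
    fun_prop
  have hint : ∀ x ∈ K, ∀ i', Integrable (fun y => G x y * ωs i' y) (volume.restrict D) := by
    intro x hx i'
    refine (hpatch i').integrable_mul (hκ _) (hGmeas x hx)
      (b := fun y => (1 / (2 * π)) * |log (dist x y)| + M) ?_ ?_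
    · exact (((integrableOn_log_dist x _ δ).mono_set ball_subset_closedBall).abs.const_mul _).add
        (integrableOn_const measure_ball_lt_top.ne)
    · intro y hy
      rw [hG, one_div (dist x y), Real.log_inv]
      refine (abs_sub _ _).trans (add_le_add ?_ (hM' x hx y (hballK _ y (ball_subset_closedBall hy))))
      rw [abs_mul, abs_neg, abs_of_pos (by positivity : (0 : ℝ) < 1 / (2 * π))]
  have hψsum : ∀ x ∈ K, ψ (∑ i', ωs i') x = ∑ i', ∫ y in D, G x y * ωs i' y := by
    intro x hx
    rw [hψ, ← integral_finsetSum _ fun i' _ => hint x hx i']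
    simp [Finset.mul_sum]
  set s : ℝ := Real.sign (κ (Fin.castAdd l i)) with hs
  have hs1 : |s| = 1 := by
    rcases Real.sign_apply_eq_of_ne_zero _ (hκ (Fin.castAdd l i)) with h | h <;> simp [hs, h]
  have hfar : ∀ i j, i ≠ j → ∀ x ∈ closedBall (xb i) δ0, ∀ y ∈ closedBall (xb j) δ,
      δ0 / 2 ≤ dist x y := by
    intro i j hij x hx y hy
    by_contra hlt
    refine Set.disjoint_left.1 (hdisj i j hij) hx ?_
    rw [mem_closedBall] at *
    linarith [dist_triangle x y (xb j)]
  have hGz : ∀ x ∈ closedBall (xb (Fin.castAdd l i)) δ0, ∀ j,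
      |s * (κ (Fin.natAdd p j) * G (z j) x)| ≤ C * |κ (Fin.natAdd p j)| := by
    intro x hx j
    rw [abs_mul, hs1, one_mul, abs_mul, mul_comm]
    refine mul_le_mul_of_nonneg_right (hC _ (hballK _ _ (hz j)) _ (hmemK _ _ hx) ?_) (abs_nonneg _)
    rw [dist_comm]
    refine hfar _ _ (fun h => ?_) x hx _ (hz j)
    have := congrArg Fin.val h
    simp at this
    omega
  have hGint : ∀ x ∈ K, ∀ i', (∀ y ∈ ball (xb (Fin.castAdd l i')) δ, δ0 / 2 ≤ dist x y) →
      |s * ∫ y in D, G x y * ωs i' y| ≤ C * |κ (Fin.castAdd l i')| := by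
    intro x hx i' hd
    rw [abs_mul, hs1, one_mul]
    exact (hpatch i').abs_integral_mul_le (hκ _) fun y hy =>
      hC x hx y (hballK _ y (ball_subset_closedBall hy)) (hd y hy)
  have hAsplit : C * A = ∑ i', C * |κ (Fin.castAdd l i')| + ∑ j, C * |κ (Fin.natAdd p j)| := by
    rw [hA, Fin.sum_univ_add, mul_add, Finset.mul_sum, Finset.mul_sum]
  have hupper : ∀ x ∈ sphere (xb (Fin.castAdd l i)) δ0,
      s * (ψ (∑ i', ωs i') x + ∑ j, κ (Fin.natAdd p j) * G (z j) x) ≤ C * A := by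
    intro x hx
    have hxb := sphere_subset_closedBall hx
    have hxK := hmemK _ x hxb
    rw [hψsum x hxK, mul_add, Finset.mul_sum, Finset.mul_sum, hAsplit]
    refine add_le_add (Finset.sum_le_sum fun i' _ => (le_abs_self _).trans
      (hGint x hxK i' fun y hy => ?_)) (Finset.sum_le_sum fun j _ => (le_abs_self _).trans (hGz x hxb j))
    by_cases hi : i = i'
    · subst hi
      rw [mem_sphere] at hx
      rw [mem_ball] at hy
      linarith [dist_triangle x y (xb (Fin.castAdd l i))]
    · exact hfar _ _ (fun h => hi (Fin.castAdd_injective _ _ h)) x hxb y (ball_subset_closedBall hy)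
  have hlower : ∀ x ∈ ball (xb (Fin.castAdd l i)) δ,
      C * A ≤ s * (ψ (∑ i', ωs i') x + ∑ j, κ (Fin.natAdd p j) * G (z j) x) := by
    intro x hx
    have hxb := closedBall_subset_closedBall (by linarith : δ ≤ δ0) (ball_subset_closedBall hx)
    have hxK := hmemK _ x hxb
    have hmain : (N - M) * |κ (Fin.castAdd l i)| ≤ s * ∫ y in D, G x y * ωs i y := by
      refine (hpatch i).le_sign_mul_integral_mul (hκ _) (hint x hxK i) ?_
      filter_upwards [measure_eq_zero_iff_ae_notMem.1 (measure_singleton (μ := volume) x)]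
        with y hyx hy
      have hpos : 0 < dist x y := dist_pos.2 fun h => hyx h.symm
      have hlt : dist x y ≤ exp (-(2 * π * N)) := by
        rw [mem_ball] at hx hy
        linarith [dist_triangle_right x y (xb (Fin.castAdd l i))]
      have hlog := Real.log_le_log hpos hlt
      rw [Real.log_exp] at hlog
      have h1 := (abs_le.1 (hM' x hxK y (hballK _ y (ball_subset_closedBall hy)))).2
      have h2 : N ≤ 1 / (2 * π) * -log (dist x y) := by
        rw [div_mul_eq_mul_div, one_mul, le_div_iff₀ (by positivity)]
        linarith
      rw [hG, one_div (dist x y), Real.log_inv]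
      linarith
    have hterm : ∀ i', (if i' = i then (N - M) * |κ (Fin.castAdd l i)| else 0)
        - C * |κ (Fin.castAdd l i')| ≤ s * ∫ y in D, G x y * ωs i' y := by
      intro i'
      split_ifs with hi
      · subst hi
        have : 0 ≤ C * |κ (Fin.castAdd l i')| := by positivity
        linarith
      · have := (abs_le.1 (hGint x hxK i' fun y hy => hfar _ _
          (fun h => hi (Fin.castAdd_injective _ _ h).symm) x hxb y (ball_subset_closedBall hy))).1
        linarith
    have hsum1 := Finset.sum_le_sum fun i' (_ : i' ∈ Finset.univ) => hterm i'
    have hsum2 := Finset.sum_le_sum fun j (_ : j ∈ Finset.univ) => (abs_le.1 (hGz x hxb j)).1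
    rw [Finset.sum_sub_distrib, Finset.sum_ite_eq' Finset.univ i, if_pos (Finset.mem_univ i)] at hsum1
    rw [Finset.sum_neg_distrib] at hsum2
    rw [hψsum x hxK, mul_add, Finset.mul_sum, Finset.mul_sum]
    linarith [hN' (Fin.castAdd l i)]
  intro x hx
  refine sub_nonpos.2 ((hupper x hx).trans
    (le_essInf_real_of_ae_le ((hpatch i).restrict_ne_zero (hκ _)) ?_))
  have hmeas : MeasurableSet {x ∈ ball (xb (Fin.castAdd l i)) δ |
      0 < Real.sign (κ (Fin.castAdd l i)) * ωs i x} :=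
    measurableSet_ball.inter
      (measurableSet_lt measurable_const ((hpatch i).measurable.const_mul _))
  filter_upwards [ae_restrict_mem hmeas] with y hy
  exact hlower y hy.1
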